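/- Let q = 2^n with n even, and a ∈ F_{q^3}^*. The map x ↦ x^{q^2+q-1} + a·x is a bijection of F_{q^3} if and only if a^{q^2+q+1} = 1 and a^{(q^2+q+1)/3} ≠ 1. -/

import Mathlib

theorem natCast_choose_two_pow_sub {R : Type*} [CommRing R] [CharP R 2] {n i : ℕ}
    (hi : i < 2 ^ (2 * n + 1)) :
    (((2 ^ (2 * n + 1) - (2 ^ n + 1)).choose i : ℕ) : R) = if i / 2 ^ n % 2 = 1 then 0 else 1 := by
  have hn : 2 ^ n < 2 ^ (2 * n + 1) := Nat.pow_lt_pow_right one_lt_two (by omega)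
  have hbit (j : ℕ) (hj : j < 2 * n + 1) :
      (2 ^ (2 * n + 1) - (2 ^ n + 1)) / 2 ^ j % 2 = if j = n then 0 else 1 := by
    have h := Nat.testBit_two_pow_sub_succ hn j
    rw [Nat.testBit_eq_decide_div_mod_eq, Nat.testBit_two_pow] at h
    rcases eq_or_ne j n with rfl | hjn
    · simpa using h
    · simpa [hj, hjn, hjn.symm] using h
  have : Fact (Nat.Prime 2) := ⟨Nat.prime_two⟩
  have lucas := Choose.choose_modEq_prod_range_choose_nat (p := 2) (a := 2 * n + 1)
    (n := 2 ^ (2 * n + 1) - (2 ^ n + 1)) (k := i) (Nat.sub_lt (by positivity) (by positivity)) hi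
  rw [(CharP.natCast_eq_natCast R 2).2 lucas]
  split_ifs with h
  · rw [Finset.prod_eq_zero (i := n) (by simp; omega)]
    · simp
    · rw [hbit n (by omega), h]; simp
  · rw [Finset.prod_eq_one]
    · simp
    · intro j hj
      rw [hbit j (by simpa using hj)]
      rcases Nat.mod_two_eq_zero_or_one (i / 2 ^ j) with h0 | h1
      · simp [h0]
      · rw [h1, if_neg (by rintro rfl; exact h h1)]; rfl

theorem FiniteField.sum_pow_eq_ite {K : Type*} [Field K] [Fintype K] {e : ℕ} (he : 0 < e) :
    ∑ x : K, x ^ e = if Fintype.card K - 1 ∣ e then -1 else 0 := by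
  classical
  rw [← FiniteField.sum_pow_units K e, ← Finset.sum_subset (Finset.subset_univ {x : K | x ≠ 0})]
  · refine (Finset.sum_bij (fun (u : Kˣ) _ => (u : K)) ?_ ?_ ?_ ?_).symm
    · simp
    · intro u _ v _ h; exact Units.ext h
    · intro x hx; exact ⟨Units.mk0 x (by simpa using hx), by simp⟩
    · simp
  · intro x _ hx
    have : x = 0 := by simpa using hx
    rw [this, zero_pow he.ne']

/-- The exponents `i` at which the power sum of `x ^ 2 + b * x ^ (q ^ 2 + q)`, `q = 3 * p + 1`,
of exponent `2 * q ^ 2 - q - 1` can have a nonzero term. -/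
theorem eq_of_dvd_of_div_even {p i : ℕ} (hp : Odd p) (hi : i ≤ 18 * p ^ 2 + 9 * p)
    (hdvd : 3 * p ^ 2 + 3 * p + 1 ∣ 4 * p + 2 + i * (p + 1))
    (heven : i / (3 * p + 1) % 2 ≠ 1) :
    i = (9 * p ^ 2 + 3 * p - 1) ∨ i = 9 * p ^ 2 + 3 * p - 1 + (3 * p ^ 2 + 3 * p + 1) ∨
      i = 9 * p ^ 2 + 3 * p - 1 + 2 * (3 * p ^ 2 + 3 * p + 1) := by
  obtain ⟨v, rfl⟩ := hp
  obtain ⟨c, hc⟩ := hdvd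
  set p := 2 * v + 1 with hpv
  have hp1 : 1 ≤ p := by omega
  have hsq : p ≤ p ^ 2 := by nlinarith
  obtain ⟨l, hl⟩ : ∃ l : ℤ, (i : ℤ) = 9 * p ^ 2 + 3 * p - 1 + l * (3 * p ^ 2 + 3 * p + 1) := by
    refine ⟨1 + i - 3 * p * c, ?_⟩
    zify at hc
    linear_combination (-3 * (p : ℤ)) * hc
  have hdiv (d r : ℕ) (hr : r < 3 * p + 1) (h : i = r + (3 * p + 1) * d) :
      i / (3 * p + 1) = d := by
    rw [h, Nat.add_mul_div_left _ _ (by omega), Nat.div_eq_of_lt hr, zero_add]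
  have hpz : (1 : ℤ) ≤ p := by exact_mod_cast hp1
  have hiz : (i : ℤ) ≤ 18 * p ^ 2 + 9 * p := by exact_mod_cast hi
  have l1 : l < 3 := by
    by_contra! h
    nlinarith [mul_le_mul_of_nonneg_right h (by positivity : (0:ℤ) ≤ 3 * p ^ 2 + 3 * p + 1)]
  have l2 : -3 < l := by
    by_contra! h
    nlinarith [mul_le_mul_of_nonneg_right h (by positivity : (0:ℤ) ≤ 3 * p ^ 2 + 3 * p + 1)]
  interval_cases l
  · exfalso
    rcases Nat.eq_zero_or_pos v with hv | hv
    · have : p = 1 := by omega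
      rw [this] at hl
      norm_num at hl
      omega
    · refine heven ?_
      rw [hdiv (p - 2) (2 * p - 1) (by omega) ?_]
      · omega
      · zify [show 2 ≤ p by omega, show 1 ≤ 2 * p by omega]
        linear_combination hl
  · exfalso
    refine heven ?_
    rw [hdiv (2 * p - 1) (p - 1) (by omega) ?_]
    · omega
    · zify [show 1 ≤ p by omega, show 1 ≤ 2 * p by omega]
      linear_combination hl
  all_goals
    rw [← Nat.cast_pow] at hl
    omega

theorem geom_sum_eq_zero_of_bijective {F : Type*} [Field F] [Fintype F] [CharP F 2] {n p : ℕ}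
    (hp : Odd p) (hq : 2 ^ n = 3 * p + 1) (hF : Fintype.card F = (2 ^ n) ^ 3) {b : F} (hb : b ≠ 0)
    (hbij : Function.Bijective fun y : F => y ^ 2 + b * y ^ ((2 ^ n) ^ 2 + 2 ^ n)) :
    1 + b ^ (3 * p ^ 2 + 3 * p + 1) + (b ^ (3 * p ^ 2 + 3 * p + 1)) ^ 2 = 0 := by
  classical
  have hp1 : 1 ≤ p := hp.pos
  have hsq : p ≤ p ^ 2 := by nlinarith
  set M := 3 * p ^ 2 + 3 * p + 1 with hM
  set i₀ := 9 * p ^ 2 + 3 * p - 1 with hi₀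
  have hi₀' : i₀ + 1 = 9 * p ^ 2 + 3 * p := by omega
  have hcard : Fintype.card F - 1 = 9 * p * M := by
    rw [hF, hq, Nat.sub_eq_iff_eq_add (Nat.one_le_pow _ _ (by omega))]; ring
  have hpow : 2 ^ (2 * n + 1) = 18 * p ^ 2 + 12 * p + 2 := by
    rw [pow_succ, mul_comm 2 n, pow_mul, hq]; ring
  have hk : 2 ^ (2 * n + 1) - (2 ^ n + 1) = 18 * p ^ 2 + 9 * p := by omega
  have hchoose {i : ℕ} (hi : i ≤ 18 * p ^ 2 + 9 * p) :
      (((18 * p ^ 2 + 9 * p).choose i : ℕ) : F) = if i / (3 * p + 1) % 2 = 1 then 0 else 1 := by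
    have h := natCast_choose_two_pow_sub (R := F) (n := n) (i := i) (by omega)
    rwa [hk, hq] at h
  have hsum : ∑ y : F, (b * y ^ ((2 ^ n) ^ 2 + 2 ^ n) + y ^ 2) ^ (18 * p ^ 2 + 9 * p) = 0 := by
    rw [← FiniteField.sum_pow_lt_card_sub_one F (18 * p ^ 2 + 9 * p) (by rw [hcard]; nlinarith)]
    exact Fintype.sum_bijective _ hbij _ _ fun y => by rw [add_comm]
  have hterm (i : ℕ) (hi : i ∈ Finset.range (18 * p ^ 2 + 9 * p + 1)) :
      ∑ y : F, (b * y ^ ((2 ^ n) ^ 2 + 2 ^ n)) ^ i * (y ^ 2) ^ (18 * p ^ 2 + 9 * p - i) *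
        (((18 * p ^ 2 + 9 * p).choose i : ℕ) : F) =
      if M ∣ 4 * p + 2 + i * (p + 1) ∧ i / (3 * p + 1) % 2 ≠ 1 then -b ^ i else 0 := by
    have hi' : i ≤ 18 * p ^ 2 + 9 * p := by simpa [Nat.lt_succ_iff] using hi
    have he : ((2 ^ n) ^ 2 + 2 ^ n) * i + 2 * (18 * p ^ 2 + 9 * p - i) =
        9 * p * (4 * p + 2 + i * (p + 1)) := by
      rw [hq]
      zify [hi']
      ring
    have hdvd : Fintype.card F - 1 ∣ 9 * p * (4 * p + 2 + i * (p + 1)) ↔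
        M ∣ 4 * p + 2 + i * (p + 1) := by
      rw [hcard]; exact Nat.mul_dvd_mul_iff_left (by positivity)
    calc _ = ∑ y : F, (b ^ i * (((18 * p ^ 2 + 9 * p).choose i : ℕ) : F)) *
          y ^ (9 * p * (4 * p + 2 + i * (p + 1))) := by
          refine Finset.sum_congr rfl fun y _ => ?_
          rw [← he, pow_add y (_ * i), pow_mul, pow_mul, mul_pow]; ring
      _ = _ := by
          rw [← Finset.mul_sum, FiniteField.sum_pow_eq_ite (by positivity), hchoose hi']
          simp only [hdvd]
          split_ifs <;> simp_all
  simp only [add_pow] at hsum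
  rw [Finset.sum_comm, Finset.sum_congr rfl hterm, ← Finset.sum_filter,
    show Finset.filter _ _ = {i₀, i₀ + M, i₀ + 2 * M} from ?_] at hsum
  · rw [Finset.sum_insert (by simp [hM]), Finset.sum_insert (by simp [hM]),
      Finset.sum_singleton] at hsum
    refine (mul_eq_zero.1 ?_).resolve_left (pow_ne_zero i₀ hb)
    linear_combination -hsum
  · ext i
    simp only [Finset.mem_filter, Finset.mem_range, Finset.mem_insert, Finset.mem_singleton]
    constructor
    · rintro ⟨hi, hdvd, heven⟩
      exact eq_of_dvd_of_div_even hp (by omega) hdvd heven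
    · have hdvd (l : ℕ) : M ∣ 4 * p + 2 + (i₀ + l * M) * (p + 1) :=
        ⟨3 * p + 1 + l * (p + 1), by
          zify at hi₀' ⊢
          rw [eq_sub_of_add_eq hi₀', hM]; push_cast; ring⟩
      have hdiv (d r l : ℕ) (hr : r < 3 * p + 1) (h : i₀ + l * M = r + (3 * p + 1) * d) :
          (i₀ + l * M) / (3 * p + 1) = d := by
        rw [h, Nat.add_mul_div_left _ _ (by omega), Nat.div_eq_of_lt hr, zero_add]
      obtain ⟨v, hv⟩ := hp
      rintro (rfl | rfl | rfl)
      · refine ⟨by omega, by simpa using hdvd 0, ?_⟩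
        have := hdiv (3 * p - 1) (3 * p) 0 (by omega) (by
          zify [show 1 ≤ 3 * p by omega] at hi₀' ⊢
          linear_combination hi₀')
        rw [zero_mul, add_zero] at this
        omega
      · refine ⟨by omega, by simpa using hdvd 1, ?_⟩
        have := hdiv (4 * p) (2 * p) 1 (by omega) (by
          zify at hi₀' ⊢
          rw [hM]; push_cast
          linear_combination hi₀')
        rw [one_mul] at this
        omega
      · refine ⟨by omega, hdvd 2, ?_⟩
        have := hdiv (5 * p + 1) p 2 (by omega) (by
          zify at hi₀' ⊢
          rw [hM]; push_cast
          linear_combination hi₀')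
        omega

/-- A circulant linear system with parameters `u, 1, 1`, where `u` is a primitive cube root of
unity, has only the trivial solution in characteristic two. -/
theorem eq_zero_of_circulant {F : Type*} [Field F] [CharP F 2] {u A B C : F}
    (hu : u ^ 2 + u + 1 = 0) (h₁ : u * A + B + C = 0) (h₂ : u * B + C + A = 0)
    (h₃ : u * C + A + B = 0) : A = 0 := by
  have h2 : (2 : F) = 0 := CharTwo.two_eq_zero
  linear_combination (1 - u ^ 2) * ((u ^ 2 - 1) * h₁ + (1 - u) * h₂ + (1 - u) * h₃) -
    A * ((1 - u ^ 2) * (u - 1) + 3 * (u - 2)) * hu - 4 * A * h2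

theorem cubic_ne_zero {F : Type*} [Field F] [CharP F 2] (σ : F →+* F)
    (hσ : ∀ x, σ (σ (σ x)) = x) {u A : F} (hu : u ^ 2 + u + 1 = 0) (hσu : σ u = u)
    (hA : A ≠ 0) :
    A ^ 3 + σ A ^ 3 + σ (σ A) ^ 3 + u * (A * σ A * σ (σ A)) ≠ 0 := by
  have h2 : (2 : F) = 0 := CharTwo.two_eq_zero
  intro h
  have hfac : (u * A + σ A + σ (σ A)) * (u * σ A + σ (σ A) + A) * (u * σ (σ A) + A + σ A) = 0 := by
    generalize σ (σ A) = C at h ⊢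
    generalize σ A = B at h ⊢
    linear_combination u * h + (A ^ 2 * B + A ^ 2 * C + B ^ 2 * A + B ^ 2 * C + C ^ 2 * A +
      C ^ 2 * B + A * B * C * (u - 2)) * hu + (2 + 2 * u) * (A * B * C) * h2
  have key {X : F} (hX : u * X + σ X + σ (σ X) = 0) : X = 0 := by
    have h₁ := congrArg σ hX
    have h₂ := congrArg σ h₁
    simp only [map_add, map_mul, hσ, hσu, map_zero] at h₁ h₂
    exact eq_zero_of_circulant hu hX h₁ h₂
  have hσA : σ A ≠ 0 := (map_ne_zero σ).2 hA
  rcases mul_eq_zero.1 hfac with h | h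
  · rcases mul_eq_zero.1 h with h | h
    · exact hA (key h)
    · exact hσA (key (by rwa [hσ]))
  · exact (map_ne_zero σ).2 hσA (key (by rwa [hσ]))

theorem exists_pow_three_eq {F : Type*} [Field F] [Fintype F] {m : ℕ}
    (hm : Fintype.card F - 1 = 3 * m) {c : F} (hc : c ≠ 0) (h : c ^ m = 1) : ∃ e, e ^ 3 = c := by
  obtain ⟨g, hg⟩ := IsCyclic.exists_generator (α := Fˣ)
  have hord : orderOf g = 3 * m := by
    rw [orderOf_eq_card_of_forall_mem_zpowers hg, Nat.card_units, Nat.card_eq_fintype_card, hm]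
  obtain ⟨j, hj⟩ := mem_powers_iff_mem_zpowers.2 (hg (Units.mk0 c hc))
  have hj' : g ^ j = Units.mk0 c hc := hj
  have hm0 : 0 < m := by
    have := Fintype.one_lt_card (α := F)
    omega
  have hone : g ^ (j * m) = 1 := by
    rw [pow_mul, hj']
    exact Units.ext (by simpa using h)
  rw [← orderOf_dvd_iff_pow_eq_one, hord] at hone
  obtain ⟨i, rfl⟩ := Nat.dvd_of_mul_dvd_mul_right hm0 hone
  exact ⟨((g ^ i : Fˣ) : F), by
    rw [← Units.val_pow_eq_pow_val, ← pow_mul, mul_comm i, hj', Units.val_mk0]⟩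

theorem injective_sq_add_mul {F : Type*} [Field F] [CharP F 2] (σ : F →+* F)
    (hσ : ∀ x, σ (σ (σ x)) = x) {b e : F} (he : b * e ^ 3 = 1)
    (hN : (e * σ e * σ (σ e)) ^ 2 + e * σ e * σ (σ e) + 1 = 0) :
    Function.Injective fun y : F => y ^ 2 + b * (σ y * σ (σ y)) := by
  have h2 : (2 : F) = 0 := CharTwo.two_eq_zero
  intro x y hxy
  by_contra hne
  have he0 : e ≠ 0 := by rintro rfl; simp at he
  obtain ⟨d, rfl⟩ : ∃ d, x = y + d := ⟨x - y, by ring⟩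
  have hd : d ≠ 0 := by rintro rfl; simp at hne
  have hG : (e * d) ^ 3 = d * (σ d * σ (σ d) + σ y * σ (σ d) + σ (σ y) * σ d) := by
    simp only [map_add] at hxy
    linear_combination e ^ 3 * d * hxy - d * (σ d * σ (σ d) + σ y * σ (σ d) + σ (σ y) * σ d) * he -
      (e ^ 3 * d ^ 2 * y + d * (σ d * σ (σ d) + σ y * σ (σ d) + σ (σ y) * σ d)) * h2
  have hG₁ := congrArg σ hG
  have hG₂ := congrArg σ hG₁
  set N := e * σ e * σ (σ e) with hNdef
  have hN3 : N ^ 3 = 1 := by linear_combination (N - 1) * hN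
  refine cubic_ne_zero σ hσ (u := N ^ 2) (A := e * d) ?_ ?_ (mul_ne_zero he0 hd) ?_
  · linear_combination (N ^ 2 - N + 1) * hN
  · simp only [hNdef, map_pow, map_mul, hσ]; ring
  · have hprod : N ^ 2 * (e * d * σ (e * d) * σ (σ (e * d))) = d * σ d * σ (σ d) := by
      simp only [map_mul]
      linear_combination (d * σ d * σ (σ d)) * hN3
    simp only [map_pow, map_mul, map_add, hσ] at hG₁ hG₂ hprod ⊢
    linear_combination hG + hG₁ + hG₂ + hprod + (2 * (d * σ d * σ (σ d)) +
      d * σ y * σ (σ d) + d * σ (σ y) * σ d + σ d * σ (σ d) * y) * h2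

theorem injective_iff_injective_sq_add_mul {F : Type*} [Field F] [Fintype F] [CharP F 2] {n : ℕ}
    (h0 : 0 < n) (hF : Fintype.card F = (2 ^ n) ^ 3) (a : F) :
    Function.Injective (fun x : F => x ^ ((2 ^ n) ^ 2 + 2 ^ n - 1) + a * x) ↔
      Function.Injective fun y : F => y ^ 2 + a ^ 2 * y ^ ((2 ^ n) ^ 2 + 2 ^ n) := by
  obtain ⟨r, hr⟩ : ∃ r, 2 ^ n = 2 * r := dvd_pow_self 2 h0.ne'
  rw [hr] at hF ⊢
  set m := (2 * r) ^ 2 + 2 * r - 1 with hm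
  set m' := 2 * r ^ 2 + r with hm'
  have hr1 : 1 ≤ r := by have := Nat.two_pow_pos n; omega
  have hmm : m * m' = 1 + (Fintype.card F - 1) * (r + 1) := by
    rw [hF, hm, hm']
    zify [Nat.one_le_pow 3 (2 * r) (by omega), show 1 ≤ (2 * r) ^ 2 + 2 * r by nlinarith]
    ring
  have hpow (y : F) : y ^ (m * m') = y := by
    rcases eq_or_ne y 0 with rfl | hy
    · exact zero_pow (by rw [hmm]; omega)
    · rw [hmm, pow_add, pow_mul, FiniteField.pow_card_sub_one_eq_one y hy, one_pow, pow_one,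
        mul_one]
  have hinj : Function.Injective fun y : F => y ^ m' := fun x y hxy => by
    rw [← hpow x, ← hpow y, mul_comm, pow_mul, pow_mul]
    exact congrArg (· ^ m) hxy
  have hcomp (y : F) : y ^ 2 + a ^ 2 * y ^ ((2 * r) ^ 2 + 2 * r) =
      ((y ^ m') ^ m + a * y ^ m') ^ 2 := by
    rw [← pow_mul, mul_comm m', hpow, CharTwo.add_sq, mul_pow a, ← pow_mul y,
      show m' * 2 = (2 * r) ^ 2 + 2 * r by rw [hm']; ring]
  simp only [hcomp]
  constructor
  · intro h x y hxy
    exact hinj (h (CharTwo.sq_injective hxy))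
  · intro h x y hxy
    have hroot (z : F) : (z ^ m) ^ m' = z := by rw [← pow_mul, hpow]
    have hxy' : x ^ m = y ^ m := h (by simpa only [hroot] using congrArg (· ^ 2) hxy)
    rw [← hroot x, hxy', hroot]

theorem stmt7 (n : ℕ) (hn : Even n) (h0 : 0 < n)
    (F : Type*) [Field F] [Fintype F] (hF : Fintype.card F = (2 ^ n) ^ 3)
    (a : F) (ha : a ≠ 0) :
    Function.Bijective (fun x : F => x ^ ((2 ^ n) ^ 2 + 2 ^ n - 1) + a * x) ↔
      (a ^ ((2 ^ n) ^ 2 + 2 ^ n + 1) = 1 ∧ a ^ (((2 ^ n) ^ 2 + 2 ^ n + 1) / 3) ≠ 1) := by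
  have : Fact (Nat.Prime 2) := ⟨Nat.prime_two⟩
  have : CharP F 2 := charP_of_card_eq_prime_pow (f := n * 3) (by rw [hF, pow_mul])
  have h2 : (2 : F) = 0 := CharTwo.two_eq_zero
  obtain ⟨p, hq, hp⟩ : ∃ p, 2 ^ n = 3 * p + 1 ∧ Odd p := by
    obtain ⟨m, rfl⟩ := hn
    have h3 : 2 ^ (m + m) % 3 = 1 := by
      rw [← two_mul, pow_mul, Nat.pow_mod]; simp
    have heven : 2 ∣ 2 ^ (m + m) := dvd_pow_self 2 h0.ne'
    exact ⟨2 ^ (m + m) / 3, by omega, by rw [Nat.odd_iff]; omega⟩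
  set M := 3 * p ^ 2 + 3 * p + 1 with hM
  have h3M : (2 ^ n) ^ 2 + 2 ^ n + 1 = 3 * M := by rw [hq, hM]; ring
  have hcard : Fintype.card F - 1 = 3 * (M * (3 * p)) := by
    rw [hF, hq, Nat.sub_eq_iff_eq_add (Nat.one_le_pow _ _ (by omega)), hM]; ring
  rw [← Finite.injective_iff_bijective, injective_iff_injective_sq_add_mul h0 hF, h3M,
    Nat.mul_div_cancel_left _ three_pos]
  constructor
  · intro h
    have hg := geom_sum_eq_zero_of_bijective hp hq hF (pow_ne_zero 2 ha)
      (Finite.injective_iff_bijective.1 h)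
    rw [← hM] at hg
    constructor
    · apply CharTwo.sq_injective
      dsimp only
      rw [one_pow, ← pow_mul, mul_assoc, mul_comm M 2, mul_comm 3, pow_mul, pow_mul]
      linear_combination ((a ^ 2) ^ M - 1) * hg
    · intro hone
      rw [← pow_mul, mul_comm 2, pow_mul, hone] at hg
      exact one_ne_zero (α := F) (by linear_combination hg - h2)
  · rintro ⟨h1, hne⟩
    have hMsum : (a ^ M) ^ 2 + a ^ M + 1 = 0 := by
      refine (mul_eq_zero.1 ?_).resolve_left (sub_ne_zero.2 hne)
      rw [mul_comm, pow_mul] at h1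
      linear_combination h1
    obtain ⟨e, he⟩ := exists_pow_three_eq hcard (inv_ne_zero (pow_ne_zero 2 ha)) (by
      rw [inv_pow, ← pow_mul, show 2 * (M * (3 * p)) = 3 * M * (2 * p) by ring, pow_mul, h1,
        one_pow, inv_one])
    set σ := iterateFrobenius F 2 n
    have hσ (x : F) : σ x = x ^ 2 ^ n := iterateFrobenius_def ..
    have hbe : a ^ 2 * e ^ 3 = 1 := by rw [he, mul_inv_cancel₀ (pow_ne_zero 2 ha)]
    have key := injective_sq_add_mul σ (b := a ^ 2) (e := e) (fun x => by
      rw [hσ, hσ, hσ, ← pow_mul, ← pow_mul, ← pow_three, ← hF, FiniteField.pow_card]) hbe ?_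
    · convert key using 3 with y
      rw [hσ, hσ, ← pow_mul y, ← pow_add y, sq (2 ^ n), add_comm]
    · have hNe : e * σ e * σ (σ e) = a ^ M := by
        have hpe : e * σ e * σ (σ e) = (e ^ 3) ^ M := by
          rw [hσ, hσ, ← pow_mul, ← pow_mul, ← h3M]; ring
        have h1' : (a ^ M) ^ 3 = 1 := by rw [← pow_mul, mul_comm, h1]
        have hbM : (a ^ M) ^ 2 * (e ^ 3) ^ M = 1 := by
          rw [← pow_mul, mul_comm M 2, pow_mul, ← mul_pow, hbe, one_pow]
        rw [hpe]
        linear_combination a ^ M * hbM - (e ^ 3) ^ M * h1'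
      rw [hNe, hMsum]
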